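/- arXiv:0704.2018 — 5 statements merged into one kernel-verified Lean document; each statement's English description precedes it below -/
import Mathlib

section
/- For every y ∈ ℝ, the Dirichlet heat kernel solves the heat equation: for all t > 0 and x ∈ ℝ, ∂/∂t g_t(x,y) = (1/2)·∂²/∂x² g_t(x,y), where both partial derivatives exist. -/
open Real

/-- The Dirichlet heat kernel on `[0,1]`:
`g_t(x,y) = ∑_{n=1}^∞ 2 exp(−n²π²t/2) sin(nπx) sin(nπy)` (indexed here by `n+1`, `n : ℕ`). -/
noncomputable def heatKernel (t x y : ℝ) : ℝ :=
  ∑' n : ℕ, 2 * Real.exp (-(((n : ℝ) + 1) ^ 2 * π ^ 2 * t) / 2) *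
    Real.sin (((n : ℝ) + 1) * π * x) * Real.sin (((n : ℝ) + 1) * π * y)

theorem summable_pow_mul_exp_neg_sq (k : ℕ) {t : ℝ} (ht : 0 < t) :
    Summable fun n : ℕ =>
      2 * (((n : ℝ) + 1) * π) ^ k * Real.exp (-(((n : ℝ) + 1) ^ 2 * π ^ 2 * t) / 2) := by
  have hr : 0 < π ^ 2 * t / 2 := by positivity
  have h := ((summable_nat_add_iff 1).2 (summable_pow_mul_exp_neg_nat_mul k hr)).mul_left (2 * π ^ k)
  refine Summable.of_nonneg_of_le (fun n => by positivity) (fun n => ?_) h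
  have hexp : Real.exp (-(((n : ℝ) + 1) ^ 2 * π ^ 2 * t) / 2) ≤
      Real.exp (-(π ^ 2 * t / 2) * ((n : ℝ) + 1)) := by
    apply Real.exp_le_exp.2
    have hn : (0 : ℝ) ≤ (n : ℝ) * ((n : ℝ) + 1) := by positivity
    nlinarith [mul_nonneg hr.le hn]
  push_cast
  calc _ ≤ 2 * (((n : ℝ) + 1) * π) ^ k * Real.exp (-(π ^ 2 * t / 2) * ((n : ℝ) + 1)) := by gcongr
    _ = _ := by rw [mul_pow]; ring

theorem abs_mul_mul_le_of_abs_le_one {c a b : ℝ} (hc : 0 ≤ c) (ha : |a| ≤ 1) (hb : |b| ≤ 1) :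
    ‖c * a * b‖ ≤ c := by
  rw [Real.norm_eq_abs, abs_mul, abs_mul, abs_of_nonneg hc]
  calc c * |a| * |b| ≤ c * 1 * 1 := by gcongr
    _ = c := by ring

theorem summable_heatKernel {t : ℝ} (ht : 0 < t) (x y : ℝ) :
    Summable fun n : ℕ => 2 * Real.exp (-(((n : ℝ) + 1) ^ 2 * π ^ 2 * t) / 2) *
      Real.sin (((n : ℝ) + 1) * π * x) * Real.sin (((n : ℝ) + 1) * π * y) := by
  refine Summable.of_norm_bounded (summable_pow_mul_exp_neg_sq 0 ht) fun n => ?_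
  rw [pow_zero, mul_one]
  exact abs_mul_mul_le_of_abs_le_one (by positivity) (abs_sin_le_one _) (abs_sin_le_one _)

theorem hasDerivAt_const_mul_sin_mul_const (c w b z : ℝ) :
    HasDerivAt (fun x => c * Real.sin (w * x) * b) (c * (Real.cos (w * z) * w) * b) z :=
  ((hasDerivAt_const_mul w).sin.const_mul c).mul_const b

theorem hasDerivAt_const_mul_cos_mul_const (c w b z : ℝ) :
    HasDerivAt (fun x => c * Real.cos (w * x) * b) (c * (-Real.sin (w * z) * w) * b) z :=
  ((hasDerivAt_const_mul w).cos.const_mul c).mul_const b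

theorem hasDerivAt_const_mul_exp_neg_mul_const (c a b s : ℝ) :
    HasDerivAt (fun t => 2 * Real.exp (-(c * t) / 2) * a * b)
      (2 * (Real.exp (-(c * s) / 2) * (-c / 2)) * a * b) s :=
  (((((hasDerivAt_const_mul c).fun_neg.div_const 2).exp.const_mul 2).mul_const a).mul_const b)

theorem hasDerivAt_heatKernel_space {t : ℝ} (ht : 0 < t) (x y : ℝ) :
    HasDerivAt (fun x' => heatKernel t x' y)
      (∑' n : ℕ, 2 * (((n : ℝ) + 1) * π) ^ 1 *
        Real.exp (-(((n : ℝ) + 1) ^ 2 * π ^ 2 * t) / 2) *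
        Real.cos (((n : ℝ) + 1) * π * x) * Real.sin (((n : ℝ) + 1) * π * y)) x := by
  refine hasDerivAt_tsum
    (g := fun (n : ℕ) (z : ℝ) => 2 * Real.exp (-(((n : ℝ) + 1) ^ 2 * π ^ 2 * t) / 2) *
      Real.sin (((n : ℝ) + 1) * π * z) * Real.sin (((n : ℝ) + 1) * π * y))
    (g' := fun (n : ℕ) (z : ℝ) => 2 * (((n : ℝ) + 1) * π) ^ 1 *
      Real.exp (-(((n : ℝ) + 1) ^ 2 * π ^ 2 * t) / 2) * Real.cos (((n : ℝ) + 1) * π * z) *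
      Real.sin (((n : ℝ) + 1) * π * y))
    (y₀ := x) (summable_pow_mul_exp_neg_sq 1 ht) (fun n z => ?_) (fun n z => ?_)
    (summable_heatKernel ht x y) x
  · exact (hasDerivAt_const_mul_sin_mul_const _ _ _ z).congr_deriv (by ring)
  · exact abs_mul_mul_le_of_abs_le_one (by positivity) (abs_cos_le_one _) (abs_sin_le_one _)

theorem hasDerivAt_deriv_heatKernel_space {t : ℝ} (ht : 0 < t) (x y : ℝ) :
    HasDerivAt (deriv fun x' => heatKernel t x' y)
      (∑' n : ℕ, 2 * (((n : ℝ) + 1) * π) ^ 2 *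
        Real.exp (-(((n : ℝ) + 1) ^ 2 * π ^ 2 * t) / 2) *
        (-Real.sin (((n : ℝ) + 1) * π * x)) * Real.sin (((n : ℝ) + 1) * π * y)) x := by
  rw [funext fun z => (hasDerivAt_heatKernel_space ht z y).deriv]
  refine hasDerivAt_tsum
    (g := fun (n : ℕ) (z : ℝ) => 2 * (((n : ℝ) + 1) * π) ^ 1 *
      Real.exp (-(((n : ℝ) + 1) ^ 2 * π ^ 2 * t) / 2) * Real.cos (((n : ℝ) + 1) * π * z) *
      Real.sin (((n : ℝ) + 1) * π * y))
    (g' := fun (n : ℕ) (z : ℝ) => 2 * (((n : ℝ) + 1) * π) ^ 2 *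
      Real.exp (-(((n : ℝ) + 1) ^ 2 * π ^ 2 * t) / 2) *
      (-Real.sin (((n : ℝ) + 1) * π * z)) * Real.sin (((n : ℝ) + 1) * π * y))
    (y₀ := x) (summable_pow_mul_exp_neg_sq 2 ht) (fun n z => ?_) (fun n z => ?_) ?_ x
  · exact (hasDerivAt_const_mul_cos_mul_const _ _ _ z).congr_deriv (by ring)
  · exact abs_mul_mul_le_of_abs_le_one (by positivity) (by simpa using abs_sin_le_one _)
      (abs_sin_le_one _)
  · refine Summable.of_norm_bounded (summable_pow_mul_exp_neg_sq 1 ht) fun n => ?_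
    exact abs_mul_mul_le_of_abs_le_one (by positivity) (abs_cos_le_one _) (abs_sin_le_one _)

theorem hasDerivAt_heatKernel_time {t : ℝ} (ht : 0 < t) (x y : ℝ) :
    HasDerivAt (fun s => heatKernel s x y)
      (∑' n : ℕ, (1 / 2) * (2 * (((n : ℝ) + 1) * π) ^ 2 *
        Real.exp (-(((n : ℝ) + 1) ^ 2 * π ^ 2 * t) / 2) *
        (-Real.sin (((n : ℝ) + 1) * π * x)) * Real.sin (((n : ℝ) + 1) * π * y))) t := by
  refine hasDerivAt_tsum_of_isPreconnected
    (g := fun (n : ℕ) (s : ℝ) => 2 * Real.exp (-(((n : ℝ) + 1) ^ 2 * π ^ 2 * s) / 2) *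
      Real.sin (((n : ℝ) + 1) * π * x) * Real.sin (((n : ℝ) + 1) * π * y))
    (g' := fun (n : ℕ) (s : ℝ) => (1 / 2) * (2 * (((n : ℝ) + 1) * π) ^ 2 *
      Real.exp (-(((n : ℝ) + 1) ^ 2 * π ^ 2 * s) / 2) *
      (-Real.sin (((n : ℝ) + 1) * π * x)) * Real.sin (((n : ℝ) + 1) * π * y)))
    (y₀ := t)
    (summable_pow_mul_exp_neg_sq 2 (half_pos ht)) (isOpen_Ioi (a := t / 2))
    isPreconnected_Ioi (fun n s _ => ?_) (fun n s hs => ?_) (half_lt_self ht)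
    (summable_heatKernel ht x y) (half_lt_self ht)
  · exact (hasDerivAt_const_mul_exp_neg_mul_const _ _ _ s).congr_deriv (by ring)
  · have hs : t / 2 ≤ s := le_of_lt hs
    have h := abs_mul_mul_le_of_abs_le_one
      (c := 2 * (((n : ℝ) + 1) * π) ^ 2 * Real.exp (-(((n : ℝ) + 1) ^ 2 * π ^ 2 * s) / 2))
      (a := -Real.sin (((n : ℝ) + 1) * π * x)) (b := Real.sin (((n : ℝ) + 1) * π * y))
      (by positivity) (by simpa using abs_sin_le_one _) (abs_sin_le_one _)
    rw [norm_mul, show ‖(1 / 2 : ℝ)‖ = 1 / 2 by norm_num]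
    refine (mul_le_of_le_one_left (norm_nonneg _) (by norm_num)).trans (h.trans ?_)
    gcongr

/-- For every `y`, the Dirichlet heat kernel solves the heat equation: for all `t > 0` and
`x ∈ ℝ`, `∂/∂t g_t(x,y) = (1/2) ∂²/∂x² g_t(x,y)`, where both partial derivatives exist
(existence of the time derivative is expressed by `HasDerivAt`, and existence of the two
spatial derivatives by the `DifferentiableAt` statements). -/
theorem heatKernel_heat_equation (y : ℝ) :
    ∀ t > (0 : ℝ), ∀ x : ℝ,
      DifferentiableAt ℝ (fun x' => heatKernel t x' y) x ∧
      DifferentiableAt ℝ (deriv fun x' => heatKernel t x' y) x ∧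
      HasDerivAt (fun s => heatKernel s x y)
        ((1 / 2) * deriv (deriv fun x' => heatKernel t x' y) x) t := by
  intro t ht x
  have hxx := hasDerivAt_deriv_heatKernel_space ht x y
  refine ⟨(hasDerivAt_heatKernel_space ht x y).differentiableAt, hxx.differentiableAt, ?_⟩
  rw [hxx.deriv, ← tsum_mul_left]
  exact hasDerivAt_heatKernel_time ht x y
end

section
/- For every t > 0 and x ∈ ℝ, ∫₀¹ g_t(x,y)² dy = Σ_{n=1}^∞ 2·exp(−n²π²t)·sin²(nπx) = g_{2t}(x,x). -/
open Real

/-- Termwise integration of an absolutely summable sine series against a continuous function. -/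
theorem hasSum_integral_sin_series_mul {a : ℕ → ℝ} (ha : Summable fun n => ‖a n‖)
    {g : ℝ → ℝ} (hg : Continuous g) :
    HasSum (fun n : ℕ => a n * ∫ y in (0:ℝ)..1, Real.sin (((n : ℝ) + 1) * π * y) * g y)
      (∫ y in (0:ℝ)..1, (∑' n : ℕ, a n * Real.sin (((n : ℝ) + 1) * π * y)) * g y) := by
  have hle (n : ℕ) (y : ℝ) : ‖a n * Real.sin (((n : ℝ) + 1) * π * y)‖ ≤ ‖a n‖ := by
    rw [norm_mul]
    exact mul_le_of_le_one_right (norm_nonneg _) (Real.abs_sin_le_one _)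
  simp_rw [← intervalIntegral.integral_const_mul]
  refine intervalIntegral.hasSum_integral_of_dominated_convergence
    (fun n y => ‖a n‖ * ‖g y‖) (fun n => ?_) (fun n => ?_) ?_ ?_ ?_
  · exact Continuous.aestronglyMeasurable (by fun_prop)
  · refine Filter.Eventually.of_forall fun y _ => ?_
    rw [← mul_assoc, norm_mul]
    exact mul_le_mul_of_nonneg_right (hle n y) (norm_nonneg _)
  · exact Filter.Eventually.of_forall fun y _ => ha.mul_right _
  · simp_rw [tsum_mul_right]
    exact Continuous.intervalIntegrable (by fun_prop) _ _
  · refine Filter.Eventually.of_forall fun y _ => ?_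
    simp_rw [← mul_assoc]
    exact (Summable.of_norm_bounded ha fun n => hle n y).hasSum.mul_right _

theorem integral_cos_int_mul_pi (k : ℤ) :
    ∫ y in (0:ℝ)..1, Real.cos ((k : ℝ) * π * y) = if k = 0 then 1 else 0 := by
  split_ifs with hk
  · simp [hk]
  · have h : (k : ℝ) * π ≠ 0 := mul_ne_zero (Int.cast_ne_zero.mpr hk) Real.pi_ne_zero
    rw [intervalIntegral.integral_comp_mul_left (fun y => Real.cos y) h]
    simp

theorem integral_sin_mul_sin_nat_succ (n m : ℕ) :
    ∫ y in (0:ℝ)..1, Real.sin (((n : ℝ) + 1) * π * y) * Real.sin (((m : ℝ) + 1) * π * y) =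
      if n = m then 1 / 2 else 0 := by
  have h (y : ℝ) : Real.sin (((n : ℝ) + 1) * π * y) * Real.sin (((m : ℝ) + 1) * π * y) =
      (Real.cos ((((n : ℤ) - m : ℤ) : ℝ) * π * y) -
        Real.cos ((((n : ℤ) + m + 2 : ℤ) : ℝ) * π * y)) / 2 := by
    have h₁ : (((n : ℤ) - m : ℤ) : ℝ) * π * y =
        ((n : ℝ) + 1) * π * y - ((m : ℝ) + 1) * π * y := by push_cast; ring
    have h₂ : (((n : ℤ) + m + 2 : ℤ) : ℝ) * π * y =
        ((n : ℝ) + 1) * π * y + ((m : ℝ) + 1) * π * y := by push_cast; ring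
    rw [h₁, h₂, Real.cos_sub, Real.cos_add]
    ring
  simp_rw [h]
  rw [intervalIntegral.integral_div, intervalIntegral.integral_sub
    (Continuous.intervalIntegrable (by fun_prop) _ _)
    (Continuous.intervalIntegrable (by fun_prop) _ _),
    integral_cos_int_mul_pi, integral_cos_int_mul_pi, if_neg (by omega : (n : ℤ) + m + 2 ≠ 0)]
  simp only [sub_eq_zero, Nat.cast_inj]
  split_ifs <;> norm_num

/-- The Parseval identity for an absolutely summable sine series. -/
theorem integral_sin_series_sq {a : ℕ → ℝ} (ha : Summable fun n => ‖a n‖) :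
    ∫ y in (0:ℝ)..1, (∑' n : ℕ, a n * Real.sin (((n : ℝ) + 1) * π * y)) ^ 2 =
      ∑' n, a n ^ 2 / 2 := by
  have hcont : Continuous fun y : ℝ => ∑' n : ℕ, a n * Real.sin (((n : ℝ) + 1) * π * y) := by
    refine continuous_tsum (fun n => by fun_prop) ha fun n y => ?_
    rw [norm_mul]
    exact mul_le_of_le_one_right (norm_nonneg _) (Real.abs_sin_le_one _)
  have hcoeff (m : ℕ) : ∫ y in (0:ℝ)..1, Real.sin (((m : ℝ) + 1) * π * y) *
      (∑' n : ℕ, a n * Real.sin (((n : ℝ) + 1) * π * y)) = a m / 2 := by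
    have h := hasSum_integral_sin_series_mul ha
      (g := fun y => Real.sin (((m : ℝ) + 1) * π * y)) (by fun_prop)
    simp_rw [integral_sin_mul_sin_nat_succ, mul_ite, mul_zero] at h
    simp_rw [mul_comm (Real.sin _) (tsum _), ← h.tsum_eq, tsum_ite_eq]
    ring
  simp_rw [pow_two (tsum _)]
  rw [← (hasSum_integral_sin_series_mul ha hcont).tsum_eq]
  refine tsum_congr fun n => ?_
  rw [hcoeff]
  ring

theorem summable_heatKernel_coeff {t : ℝ} (ht : 0 < t) (x : ℝ) :
    Summable fun n : ℕ => ‖2 * Real.exp (-(((n : ℝ) + 1) ^ 2 * π ^ 2 * t) / 2) *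
      Real.sin (((n : ℝ) + 1) * π * x)‖ := by
  have hc : -(π ^ 2 * t / 2) < 0 := by
    have := Real.pi_pos
    exact neg_neg_of_pos (by positivity)
  refine Summable.of_nonneg_of_le (fun _ => norm_nonneg _) (fun n => ?_)
    ((Real.summable_exp_nat_mul_iff.mpr hc).mul_left 2)
  rw [norm_mul, Real.norm_of_nonneg (by positivity)]
  refine (mul_le_of_le_one_right (by positivity) (Real.abs_sin_le_one _)).trans ?_
  gcongr
  have hn : (n : ℝ) ≤ ((n : ℝ) + 1) ^ 2 := by nlinarith [(n.cast_nonneg : (0 : ℝ) ≤ n)]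
  nlinarith [mul_le_mul_of_nonpos_right hn hc.le]

/-- For every `t > 0` and `x ∈ ℝ`,
`∫₀¹ g_t(x,y)² dy = ∑_{n=1}^∞ 2 exp(−n²π²t) sin²(nπx) = g_{2t}(x,x)`. -/
theorem heatKernel_sq_integral (t : ℝ) (ht : 0 < t) (x : ℝ) :
    (∫ y in (0:ℝ)..1, (heatKernel t x y) ^ 2) =
      (∑' n : ℕ, 2 * Real.exp (-(((n : ℝ) + 1) ^ 2 * π ^ 2 * t)) *
        Real.sin (((n : ℝ) + 1) * π * x) ^ 2) ∧
    (∑' n : ℕ, 2 * Real.exp (-(((n : ℝ) + 1) ^ 2 * π ^ 2 * t)) *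
        Real.sin (((n : ℝ) + 1) * π * x) ^ 2) = heatKernel (2 * t) x x := by
  constructor
  · simp_rw [heatKernel]
    rw [integral_sin_series_sq (summable_heatKernel_coeff ht x)]
    refine tsum_congr fun n => ?_
    rw [mul_pow, mul_pow, ← Real.exp_nat_mul]
    push_cast
    rw [mul_div_cancel₀ _ (two_ne_zero' ℝ)]
    ring
  · refine tsum_congr fun n => ?_
    rw [show -(((n : ℝ) + 1) ^ 2 * π ^ 2 * (2 * t)) / 2 = -(((n : ℝ) + 1) ^ 2 * π ^ 2 * t) by ring]
    ring
end

section
/- The Dirichlet heat kernel has the Dirac delta as initial condition: if h : [0,1] → ℝ is continuous with h(0) = h(1) = 0, then for every x ∈ [0,1], ∫₀¹ g_t(x,y)·h(y) dy → h(x) as t → 0⁺. -/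
open Real Filter Topology

section Convolution

open MeasureTheory ProbabilityTheory AddCircle

/-- The law on the circle of a centered Gaussian variable with standard deviation `c`. -/
noncomputable def wrappedGaussian (T c : ℝ) : Measure (AddCircle T) :=
  (gaussianReal 0 1).map fun w : ℝ => ((c * w : ℝ) : AddCircle T)

lemma continuous_coe_mul {T : ℝ} (c : ℝ) : Continuous fun w : ℝ => ((c * w : ℝ) : AddCircle T) :=
  (AddCircle.continuous_mk' T).comp (continuous_const_mul c)

instance {T : ℝ} (c : ℝ) : IsProbabilityMeasure (wrappedGaussian T c) :=
  Measure.isProbabilityMeasure_map (continuous_coe_mul c).aemeasurable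

lemma integral_wrappedGaussian {T : ℝ} (c : ℝ) {f : AddCircle T → ℂ} (hf : Continuous f) :
    ∫ w, f w ∂wrappedGaussian T c = ∫ w : ℝ, f ((c * w : ℝ) : AddCircle T) ∂gaussianReal 0 1 :=
  integral_map (continuous_coe_mul c).aemeasurable hf.aestronglyMeasurable

lemma integral_fourier_wrappedGaussian {T : ℝ} (c : ℝ) (n : ℤ) :
    ∫ w, fourier n w ∂wrappedGaussian T c = (rexp (-(2 * π * n * c / T) ^ 2 / 2) : ℝ) := by
  rw [integral_wrappedGaussian c (map_continuous _)]
  have := charFun_gaussianReal (μ := 0) (v := 1) (2 * π * n * c / T)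
  rw [charFun_apply_real] at this
  simp_rw [fourier_coe_apply]
  convert! this using 1
  · congr 1 with w
    push_cast
    ring_nf
  · push_cast
    ring_nf

variable {T : ℝ} [Fact (0 < T)]

lemma continuous_integral_add (μ : Measure (AddCircle T)) [IsFiniteMeasure μ]
    (F : C(AddCircle T, ℂ)) : Continuous fun z => ∫ w, F (z + w) ∂μ := by
  refine continuous_of_dominated (bound := fun _ => ‖F‖) (fun z => ?_) (fun z => ?_)
    (integrable_const _) ?_
  · exact Continuous.aestronglyMeasurable (by fun_prop)
  · exact .of_forall fun w => F.norm_coe_le_norm _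
  · exact .of_forall fun w => by fun_prop

lemma fourierCoeff_integral_add (μ : Measure (AddCircle T)) [IsFiniteMeasure μ]
    (F : C(AddCircle T, ℂ)) (n : ℤ) :
    fourierCoeff (fun z => ∫ w, F (z + w) ∂μ) n = fourierCoeff F n * ∫ w, fourier n w ∂μ := by
  have translate (w : AddCircle T) :
      ∫ z, fourier (-n) z • F (z + w) ∂haarAddCircle = fourierCoeff F n * fourier n w := by
    rw [fourierCoeff, ← integral_mul_const,
      ← integral_add_right_eq_self (fun z => fourier (-n) z • F z * fourier n w) w]
    congr 1 with z
    have h : fourier (-n) w * fourier n w = 1 := by rw [← fourier_add]; simp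
    have h' : fourier (-n) (z + w) = fourier (-n) z * fourier (-n) w := by
      simp [fourier_apply, toCircle_add]
    rw [h', smul_eq_mul, smul_eq_mul]
    linear_combination (-fourier (-n) z * F (z + w)) * h
  simp_rw [fourierCoeff, ← integral_smul]
  rw [integral_integral_swap]
  · simp_rw [translate, integral_const_mul, fourierCoeff]
  · refine Integrable.of_bound (C := ‖F‖) (Continuous.aestronglyMeasurable ?_)
      (.of_forall fun p => ?_)
    · simp only [Function.uncurry_def]
      fun_prop
    · simpa [Function.uncurry_def, norm_smul, Circle.norm_coe] using F.norm_coe_le_norm _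

lemma hasSum_fourier_integral_add (μ : Measure (AddCircle T)) [IsFiniteMeasure μ]
    (F : C(AddCircle T, ℂ)) (hs : Summable fun n : ℤ => ∫ w, fourier n w ∂μ) (x : AddCircle T) :
    HasSum (fun n : ℤ => fourierCoeff F n * (∫ w, fourier n w ∂μ) * fourier n x)
      (∫ w, F (x + w) ∂μ) := by
  let G : C(AddCircle T, ℂ) := ⟨_, continuous_integral_add μ F⟩
  have hG : fourierCoeff G = fun n : ℤ => fourierCoeff F n * ∫ w, fourier n w ∂μ :=
    funext (fourierCoeff_integral_add μ F)
  have hsum : Summable (fourierCoeff G) := by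
    rw [hG]
    refine Summable.of_norm_bounded (hs.norm.mul_left ‖F‖) fun n => ?_
    rw [norm_mul]
    gcongr
    refine (norm_integral_le_of_norm_le_const (C := ‖F‖) (.of_forall fun z => ?_)).trans_eq ?_
    · simpa [norm_smul, Circle.norm_coe] using F.norm_coe_le_norm z
    · simp
  have := has_pointwise_sum_fourier_series_of_summable hsum x
  simp only [hG, smul_eq_mul] at this
  exact this

lemma summable_exp_neg_mul_int_sq {a : ℝ} (ha : 0 < a) :
    Summable fun n : ℤ => rexp (-a * (n : ℝ) ^ 2) := by
  have h : Summable fun n : ℕ => rexp (-a * (n : ℝ) ^ 2) :=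
    Real.summable_exp_nat_mul_of_ge (neg_neg_of_pos ha)
      fun n => mod_cast Nat.le_self_pow two_ne_zero n
  exact Summable.of_nat_of_neg (by simpa using h) (by simpa using h)

lemma hasSum_fourier_wrappedGaussian (F : C(AddCircle T, ℂ)) {c : ℝ} (hc : c ≠ 0)
    (x : AddCircle T) :
    HasSum (fun n : ℤ => fourierCoeff F n * (rexp (-(2 * π * n * c / T) ^ 2 / 2) : ℝ) *
      fourier n x) (∫ w, F (x + w) ∂wrappedGaussian T c) := by
  have hT : T ≠ 0 := (Fact.out : 0 < T).ne'
  simp_rw [← integral_fourier_wrappedGaussian]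
  refine hasSum_fourier_integral_add _ F ?_ x
  simp_rw [integral_fourier_wrappedGaussian]
  refine Complex.ofRealCLM.summable (f := fun n : ℤ => rexp (-(2 * π * n * c / T) ^ 2 / 2)) ?_
  have h : 0 < (2 * π * c / T) ^ 2 / 2 := by positivity
  refine (summable_exp_neg_mul_int_sq h).congr fun n => ?_
  congr 1
  ring

lemma tendsto_integral_add_wrappedGaussian (F : C(AddCircle T, ℂ)) (x : AddCircle T) :
    Tendsto (fun c => ∫ w, F (x + w) ∂wrappedGaussian T c) (𝓝 0) (𝓝 (F x)) := by
  have h (c : ℝ) := integral_wrappedGaussian c (f := fun w => F (x + w)) (by fun_prop)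
  simp_rw [h]
  have hx : F x = ∫ _ : ℝ, F x ∂gaussianReal 0 1 := by simp
  rw [hx]
  refine tendsto_integral_filter_of_dominated_convergence (fun _ => ‖F‖) (.of_forall fun c => ?_)
    (.of_forall fun c => .of_forall fun w => F.norm_coe_le_norm _) (integrable_const _)
    (.of_forall fun w => ?_)
  · exact (F.continuous.comp (continuous_const.add (continuous_coe_mul c))).aestronglyMeasurable
  · have hcont : Continuous fun c : ℝ => F (x + ((c * w : ℝ) : AddCircle T)) :=
      F.continuous.comp (continuous_const.add
        ((AddCircle.continuous_mk' T).comp (continuous_mul_const w)))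
    simpa using hcont.tendsto 0

end Convolution

section OddExtension

/-- The odd extension to `ℝ` of a function on `[0, ∞)`. -/
noncomputable def oddExtension (h : ℝ → ℝ) (y : ℝ) : ℝ := if 0 ≤ y then h y else -h (-y)

lemma continuousOn_oddExtension {h : ℝ → ℝ} (hc : ContinuousOn h (Set.Icc 0 1)) (h0 : h 0 = 0) :
    ContinuousOn (oddExtension h) (Set.Icc (-1) 1) := by
  have hu : Set.Icc (-1 : ℝ) 1 = Set.Icc (-1) 0 ∪ Set.Icc 0 1 :=
    (Set.Icc_union_Icc_eq_Icc (by norm_num) (by norm_num)).symm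
  rw [hu]
  refine ContinuousOn.union_of_isClosed ?_ ?_ isClosed_Icc isClosed_Icc
  · have : ContinuousOn (fun y => -h (-y)) (Set.Icc (-1) 0) :=
      (hc.comp continuousOn_neg fun y hy => ⟨by linarith [hy.2], by linarith [hy.1]⟩).neg
    refine this.congr fun y hy => ?_
    rcases hy.2.lt_or_eq with hy | rfl
    · simp [oddExtension, not_le.2 hy]
    · simp [oddExtension, h0]
  · exact hc.congr fun y hy => by simp [oddExtension, hy.1]

lemma integral_smul_oddExtension {h : ℝ → ℝ} (hc : ContinuousOn h (Set.Icc 0 1)) (h0 : h 0 = 0)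
    {u : ℝ → ℂ} (hu : Continuous u) :
    ∫ y in (-1 : ℝ)..1, u y * oddExtension h y = ∫ y in (0 : ℝ)..1, (u y - u (-y)) * h y := by
  have hint : ContinuousOn (fun y => u y * oddExtension h y) (Set.Icc (-1) 1) :=
    hu.continuousOn.mul (Complex.continuous_ofReal.comp_continuousOn
      (continuousOn_oddExtension hc h0))
  have hcC : ContinuousOn (fun y => (h y : ℂ)) (Set.Icc 0 1) :=
    Complex.continuous_ofReal.comp_continuousOn hc
  have i1 : IntervalIntegrable (fun y => u y * oddExtension h y) MeasureTheory.volume (-1) 0 :=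
    (hint.mono (Set.Icc_subset_Icc le_rfl zero_le_one)).intervalIntegrable_of_Icc (by norm_num)
  have i2 : IntervalIntegrable (fun y => u y * oddExtension h y) MeasureTheory.volume 0 1 :=
    (hint.mono (Set.Icc_subset_Icc (by norm_num) le_rfl)).intervalIntegrable_of_Icc zero_le_one
  rw [← intervalIntegral.integral_add_adjacent_intervals i1 i2]
  have e2 : ∫ y in (0 : ℝ)..1, u y * oddExtension h y = ∫ y in (0 : ℝ)..1, u y * h y := by
    refine intervalIntegral.integral_congr fun y hy => ?_
    rw [Set.uIcc_of_le zero_le_one] at hy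
    simp [oddExtension, hy.1]
  have e1 : ∫ y in (-1 : ℝ)..0, u y * oddExtension h y = ∫ y in (0 : ℝ)..1, -(u (-y) * h y) := by
    have := intervalIntegral.integral_comp_neg (a := 0) (b := 1)
      fun y => u y * (oddExtension h y : ℂ)
    rw [neg_zero] at this
    rw [← this]
    refine intervalIntegral.integral_congr fun y hy => ?_
    rw [Set.uIcc_of_le zero_le_one] at hy
    rcases hy.1.lt_or_eq with hy | rfl
    · simp [oddExtension, not_le.2 hy]
    · simp [oddExtension, h0]
  rw [e1, e2, ← intervalIntegral.integral_add]
  · congr 1 with y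
    ring
  · exact ((hu.comp continuous_neg).continuousOn.mul hcC).neg.intervalIntegrable_of_Icc zero_le_one
  · exact (hu.continuousOn.mul hcC).intervalIntegrable_of_Icc zero_le_one

instance : Fact ((0 : ℝ) < 2) := ⟨two_pos⟩

/-- The odd, `2`-periodic extension of a continuous function on `[0, 1]` vanishing at the
endpoints. -/
noncomputable def oddPeriodicExtension (h : ℝ → ℝ) (hc : ContinuousOn h (Set.Icc 0 1))
    (h0 : h 0 = 0) (h1 : h 1 = 0) : C(AddCircle (2 : ℝ), ℂ) where
  toFun := AddCircle.liftIco 2 (-1) fun y => (oddExtension h y : ℂ)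
  continuous_toFun := by
    have he : (-1 : ℝ) + 2 = 1 := by norm_num
    refine AddCircle.liftIco_continuous ?_ ?_
    · rw [he]
      simp [oddExtension, h1, not_le.2 (neg_one_lt_zero (R := ℝ))]
    · rw [he]
      exact Complex.continuous_ofReal.comp_continuousOn (continuousOn_oddExtension hc h0)

variable {h : ℝ → ℝ} (hc : ContinuousOn h (Set.Icc 0 1)) (h0 : h 0 = 0) (h1 : h 1 = 0)

lemma oddPeriodicExtension_coe {x : ℝ} (hx : x ∈ Set.Icc (-1 : ℝ) 1) :
    oddPeriodicExtension h hc h0 h1 (x : AddCircle (2 : ℝ)) = oddExtension h x := by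
  have he : (-1 : ℝ) + 2 = 1 := by norm_num
  rcases hx.2.lt_or_eq with hlt | rfl
  · exact AddCircle.liftIco_coe_apply (f := fun y => (oddExtension h y : ℂ)) ⟨hx.1, by rwa [he]⟩
  · have h2 : ((1 : ℝ) : AddCircle (2 : ℝ)) = ((-1 : ℝ) : AddCircle (2 : ℝ)) := by
      rw [← AddCircle.coe_add_period 2 (-1), he]
    rw [h2]
    refine (AddCircle.liftIco_coe_apply (f := fun y => (oddExtension h y : ℂ))
      ⟨le_rfl, by norm_num⟩).trans ?_
    simp [oddExtension, h1, not_le.2 (neg_one_lt_zero (R := ℝ))]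

lemma fourierCoeff_oddPeriodicExtension (n : ℤ) :
    fourierCoeff (oddPeriodicExtension h hc h0 h1) n =
      -Complex.I * ((∫ y in (0 : ℝ)..1, sin (n * π * y) * h y : ℝ) : ℂ) := by
  have he : (-1 : ℝ) + 2 = 1 := by norm_num
  rw [fourierCoeff_eq_intervalIntegral _ _ (-1), he]
  have e : ∫ y in (-1 : ℝ)..1, fourier (-n) (y : AddCircle (2 : ℝ)) •
      oddPeriodicExtension h hc h0 h1 y =
      ∫ y in (-1 : ℝ)..1, fourier (-n) (y : AddCircle (2 : ℝ)) * (oddExtension h y : ℂ) := by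
    refine intervalIntegral.integral_congr fun y hy => ?_
    rw [Set.uIcc_of_le (by norm_num)] at hy
    simp only [oddPeriodicExtension_coe hc h0 h1 hy, smul_eq_mul]
  rw [e, integral_smul_oddExtension hc h0
    (u := fun y => fourier (-n) (y : AddCircle (2 : ℝ)))
    ((map_continuous _).comp (AddCircle.continuous_mk' 2)), ← intervalIntegral.integral_ofReal,
    ← intervalIntegral.integral_smul, ← intervalIntegral.integral_const_mul]
  congr 1 with y
  have a1 : 2 * (π : ℂ) * Complex.I * ((-n : ℤ) : ℂ) * (y : ℂ) / ((2 : ℝ) : ℂ) =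
      -(n * π * y) * Complex.I := by push_cast; ring
  have a2 : 2 * (π : ℂ) * Complex.I * ((-n : ℤ) : ℂ) * ((-y : ℝ) : ℂ) / ((2 : ℝ) : ℂ) =
      (n * π * y) * Complex.I := by push_cast; ring
  rw [fourier_coe_apply, fourier_coe_apply, a1, a2, Complex.real_smul]
  push_cast
  rw [Complex.sin]
  linear_combination ((Complex.exp (-(n * π * y) * Complex.I) -
    Complex.exp ((n * π * y) * Complex.I)) * h y / 2) * Complex.I_sq

end OddExtension

lemma hasSum_integral_heatKernel_mul {h : ℝ → ℝ} (hc : ContinuousOn h (Set.Icc 0 1))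
    {t : ℝ} (ht : 0 < t) (x : ℝ) :
    HasSum (fun n : ℕ => 2 * rexp (-(((n : ℝ) + 1) ^ 2 * π ^ 2 * t) / 2) *
      sin (((n : ℝ) + 1) * π * x) * ∫ y in (0 : ℝ)..1, sin (((n : ℝ) + 1) * π * y) * h y)
      (∫ y in (0 : ℝ)..1, heatKernel t x y * h y) := by
  obtain ⟨C, hC⟩ := isCompact_Icc.exists_bound_of_continuousOn hc
  set b : ℕ → ℝ := fun n => 2 * rexp (-(((n : ℝ) + 1) ^ 2 * π ^ 2 * t) / 2) with hb
  have hbs : Summable b := by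
    have ha : 0 < π ^ 2 * t / 2 := by positivity
    have := (summable_nat_add_iff 1).2
      ((summable_exp_neg_mul_int_sq ha).comp_injective Nat.cast_injective)
    refine (this.mul_left 2).congr fun n => ?_
    simp only [hb, Function.comp_apply]
    push_cast
    ring_nf
  have hk (n : ℕ) (y : ℝ) :
      ‖b n * sin (((n : ℝ) + 1) * π * x) * sin (((n : ℝ) + 1) * π * y)‖ ≤ b n := by
    have hb0 : 0 ≤ b n := by positivity
    rw [norm_mul, norm_mul, Real.norm_of_nonneg hb0, mul_assoc]
    refine mul_le_of_le_one_right hb0 (mul_le_one₀ (abs_sin_le_one _) (abs_nonneg _)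
      (abs_sin_le_one _))
  simp_rw [← intervalIntegral.integral_const_mul]
  refine intervalIntegral.hasSum_integral_of_dominated_convergence (fun n _ => b n * C)
    (fun n => ?_) (fun n => .of_forall fun y hy => ?_) (.of_forall fun _ _ => hbs.mul_right C)
    intervalIntegrable_const (.of_forall fun y _ => ?_)
  · rw [Set.uIoc_of_le zero_le_one]
    refine ContinuousOn.aestronglyMeasurable ?_ measurableSet_Ioc
    have := hc.mono Set.Ioc_subset_Icc_self
    fun_prop
  · rw [Set.uIoc_of_le zero_le_one] at hy
    rw [← mul_assoc, norm_mul]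
    have := hC y (Set.Ioc_subset_Icc_self hy)
    exact mul_le_mul (hk n y) this (norm_nonneg _) (by positivity)
  · simp_rw [← mul_assoc]
    exact (Summable.of_norm_bounded hbs fun n => hk n y).hasSum.mul_right (h y)

/-- The heat semigroup on `[0, 1]` with Dirichlet conditions is the convolution of the odd periodic
extension with a Gaussian. -/
lemma integral_heatKernel_mul {h : ℝ → ℝ} (hc : ContinuousOn h (Set.Icc 0 1))
    (h0 : h 0 = 0) (h1 : h 1 = 0) {t : ℝ} (ht : 0 < t) (x : ℝ) :
    ((∫ y in (0 : ℝ)..1, heatKernel t x y * h y : ℝ) : ℂ) =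
      ∫ w, oddPeriodicExtension h hc h0 h1 (x + w) ∂wrappedGaussian 2 √t := by
  have hsum := (hasSum_fourier_wrappedGaussian (oddPeriodicExtension h hc h0 h1)
    (sqrt_pos.2 ht).ne' (x : AddCircle (2 : ℝ))).nat_add_neg
  rw [← hasSum_nat_add_iff' 1] at hsum
  refine (Complex.hasSum_ofReal.2 (hasSum_integral_heatKernel_mul hc ht x)).unique ?_
  convert! hsum using 1
  · ext n
    have hn : -(2 * π * ((n + 1 : ℕ) : ℤ) * √t / 2) ^ 2 / 2 =
        -(((n : ℝ) + 1) ^ 2 * π ^ 2 * t) / 2 := by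
      rw [div_pow, mul_pow, sq_sqrt ht.le]
      push_cast
      ring
    have hn' : -(2 * π * ((-((n + 1 : ℕ) : ℤ) : ℤ) : ℝ) * √t / 2) ^ 2 / 2 =
        -(((n : ℝ) + 1) ^ 2 * π ^ 2 * t) / 2 := by
      rw [← hn]
      push_cast
      ring
    have hq : ∫ y in (0 : ℝ)..1, sin (((-((n + 1 : ℕ) : ℤ) : ℤ) : ℝ) * π * y) * h y =
        -∫ y in (0 : ℝ)..1, sin (((n : ℝ) + 1) * π * y) * h y := by
      rw [← intervalIntegral.integral_neg]
      congr 1 with y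
      rw [← neg_mul, ← sin_neg]
      push_cast
      ring_nf
    have a1 : 2 * (π : ℂ) * Complex.I * (((n + 1 : ℕ) : ℤ) : ℂ) * (x : ℂ) / ((2 : ℝ) : ℂ) =
        ((n + 1) * π * x) * Complex.I := by push_cast; ring
    have a2 : 2 * (π : ℂ) * Complex.I * ((-((n + 1 : ℕ) : ℤ) : ℤ) : ℂ) * (x : ℂ) /
        ((2 : ℝ) : ℂ) = -((n + 1) * π * x) * Complex.I := by push_cast; ring
    rw [fourierCoeff_oddPeriodicExtension, fourierCoeff_oddPeriodicExtension, hn, hn', hq,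
      fourier_coe_apply, fourier_coe_apply, a1, a2]
    push_cast
    rw [Complex.sin]
    ring
  · simp [fourierCoeff_oddPeriodicExtension]

/-- The Dirichlet heat kernel has the Dirac delta as initial condition: if `h : [0,1] → ℝ` is
continuous with `h(0) = h(1) = 0`, then for every `x ∈ [0,1]`,
`∫₀¹ g_t(x,y) h(y) dy → h(x)` as `t → 0⁺`. -/
theorem heatKernel_dirac_initial (h : ℝ → ℝ) (hc : ContinuousOn h (Set.Icc (0:ℝ) 1))
    (h0 : h 0 = 0) (h1 : h 1 = 0) :
    ∀ x ∈ Set.Icc (0:ℝ) 1,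
      Tendsto (fun t => ∫ y in (0:ℝ)..1, heatKernel t x y * h y) (𝓝[>] (0:ℝ)) (𝓝 (h x)) := by
  intro x hx
  have hFx : oddPeriodicExtension h hc h0 h1 (x : AddCircle (2 : ℝ)) = h x := by
    rw [oddPeriodicExtension_coe hc h0 h1 ⟨by linarith [hx.1], hx.2⟩]
    simp [oddExtension, hx.1]
  have hsqrt : Tendsto (fun t : ℝ => √t) (𝓝[>] 0) (𝓝 0) := by
    simpa using (continuous_sqrt.tendsto 0).mono_left nhdsWithin_le_nhds
  have hlim := (tendsto_integral_add_wrappedGaussian (oddPeriodicExtension h hc h0 h1)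
    (x : AddCircle (2 : ℝ))).comp hsqrt
  rw [hFx] at hlim
  have hre := (Complex.continuous_re.tendsto _).comp hlim
  refine (Complex.ofReal_re (h x) ▸ hre).congr' ?_
  filter_upwards [self_mem_nhdsWithin] with t ht
  simp [← integral_heatKernel_mul hc h0 h1 ht x]
end

section
/- Deterministic Itô-type chain rule: let t > 0, let a : [0,t] → ℝ be continuously differentiable, nondecreasing, with a(0) = 0 and a(v) > 0 for v > 0, let b : [0,t] → ℝ be continuously differentiable, and let φ : ℝ → ℝ be twice continuously differentiable with φ, φ', φ'' bounded. Then (P_{a(t)} φ)(b(t)) = φ(b(0)) + ∫₀ᵗ (P_{a(v)} φ')(b(v))·b'(v) dv + (1/2)·∫₀ᵗ (P_{a(v)} φ'')(b(v))·a'(v) dv. -/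
open Real MeasureTheory

/-- The Gauss–Weierstrass (heat) semigroup:
`(P_t φ)(x) = ∫_ℝ φ(y) (2πt)^{−1/2} exp(−(x−y)²/(2t)) dy` for `t > 0`, and `P_0 φ = φ`. -/
noncomputable def heatSemigroup (t : ℝ) (φ : ℝ → ℝ) (x : ℝ) : ℝ :=
  if 0 < t then
    ∫ y : ℝ, φ y * ((Real.sqrt (2 * π * t))⁻¹ * Real.exp (-(x - y) ^ 2 / (2 * t)))
  else φ x

open ProbabilityTheory

lemma integrable_comp_add_mul_gaussianReal {ψ : ℝ → ℝ} (hψ : Continuous ψ) {C : ℝ}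
    (hC : ∀ x, |ψ x| ≤ C) (x s : ℝ) :
    Integrable (fun z => ψ (x + s * z)) (gaussianReal 0 1) :=
  .of_bound (by fun_prop) C (ae_of_all _ fun _ => hC _)

lemma integrable_comp_add_mul_mul_self_gaussianReal {ψ : ℝ → ℝ} (hψ : Continuous ψ) {C : ℝ}
    (hC : ∀ x, |ψ x| ≤ C) (x s : ℝ) :
    Integrable (fun z => ψ (x + s * z) * z) (gaussianReal 0 1) := by
  have hid : Integrable (fun z : ℝ => z) (gaussianReal 0 1) :=
    memLp_one_iff_integrable.1 (memLp_id_gaussianReal 1)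
  exact hid.bdd_mul (c := C) (by fun_prop) (ae_of_all _ fun _ => hC _)

lemma heatSemigroup_eq_integral_gaussianReal {ψ : ℝ → ℝ} (hψ : Continuous ψ) {s : ℝ}
    (hs : 0 ≤ s) (x : ℝ) :
    heatSemigroup s ψ x = ∫ z, ψ (x + √s * z) ∂gaussianReal 0 1 := by
  rcases hs.eq_or_lt with rfl | hs
  · simp [heatSemigroup]
  have hmap : (gaussianReal 0 1).map (fun z => x + √s * z) = gaussianReal x s.toNNReal := by
    change (gaussianReal 0 1).map ((x + ·) ∘ (√s * ·)) = _
    rw [← Measure.map_map (by fun_prop) (by fun_prop),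
      gaussianReal_map_const_mul, gaussianReal_map_const_add]
    congr 1
    · simp
    · ext
      simp [Real.sq_sqrt hs.le, hs.le]
  rw [← integral_map (φ := fun z => x + √s * z) (by fun_prop) hψ.aestronglyMeasurable, hmap,
    integral_gaussianReal_eq_integral_smul (Real.toNNReal_pos.2 hs).ne', heatSemigroup, if_pos hs]
  congr with y
  rw [gaussianPDFReal_def, smul_eq_mul, mul_comm, ← neg_sub y x, neg_sq, Real.coe_toNNReal _ hs.le]

/-- Stein's identity for the standard Gaussian. -/
lemma integral_comp_add_mul_mul_self_gaussianReal {ψ : ℝ → ℝ} (hψ : ContDiff ℝ 1 ψ)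
    {C D : ℝ} (hC : ∀ x, |ψ x| ≤ C) (hD : ∀ x, |deriv ψ x| ≤ D) (x s : ℝ) :
    ∫ z, ψ (x + s * z) * z ∂gaussianReal 0 1 =
      s * ∫ z, deriv ψ (x + s * z) ∂gaussianReal 0 1 := by
  have hψ' : Continuous (deriv ψ) := hψ.continuous_deriv le_rfl
  have hdiff := hψ.differentiable one_ne_zero
  have hint : ∀ f : ℝ → ℝ, Integrable f (gaussianReal 0 1) →
      Integrable (fun z => f z * gaussianPDFReal 0 1 z) := by
    intro f hf
    rw [gaussianReal_of_var_ne_zero _ one_ne_zero,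
      integrable_withDensity_iff (measurable_gaussianPDF _ _)
        (ae_of_all _ fun _ => gaussianPDF_lt_top)] at hf
    simpa using hf
  have hpdf : ∀ z, HasDerivAt (gaussianPDFReal 0 1) (-(z * gaussianPDFReal 0 1 z)) z := by
    intro z
    rw [gaussianPDFReal_def]
    have h1 : HasDerivAt (fun y : ℝ => -(y - 0) ^ 2 / (2 * ((1 : NNReal) : ℝ))) (-z) z := by
      convert! ((((hasDerivAt_id z).sub_const 0).pow 2).neg.div_const
        (2 * ((1 : NNReal) : ℝ))) using 1
      simp; ring
    convert! h1.exp.const_mul ((√(2 * π * ((1 : NNReal) : ℝ)))⁻¹) using 1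
    ring
  have hu : ∀ z, HasDerivAt (fun z => ψ (x + s * z)) (deriv ψ (x + s * z) * s) z := by
    intro z
    have h1 : HasDerivAt (fun z => x + s * z) s z := by
      simpa using ((hasDerivAt_id z).const_mul s).const_add x
    exact (hdiff _).hasDerivAt.comp z h1
  have key := integral_mul_deriv_eq_deriv_mul_of_integrable
    (u := fun z => ψ (x + s * z)) (v := gaussianPDFReal 0 1)
    (fun z _ => hu z) (fun z _ => hpdf z)
    ((hint _ (integrable_comp_add_mul_mul_self_gaussianReal hψ.continuous hC x s)).neg.congr
      (ae_of_all _ fun z => by simp [mul_assoc]))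
    (hint _ ((integrable_comp_add_mul_gaussianReal hψ' hD x s).mul_const s))
    (hint _ (integrable_comp_add_mul_gaussianReal hψ.continuous hC x s))
  rw [integral_gaussianReal_eq_integral_smul one_ne_zero,
    integral_gaussianReal_eq_integral_smul one_ne_zero, ← integral_const_mul]
  simp only [smul_eq_mul, mul_neg, integral_neg, neg_inj] at key ⊢
  convert! key using 2 <;> ext z <;> ring

lemma hasFDerivAt_integral_comp_add_mul_gaussianReal {ψ : ℝ → ℝ} (hψ : ContDiff ℝ 1 ψ)
    {C D : ℝ} (hC : ∀ x, |ψ x| ≤ C) (hD : ∀ x, |deriv ψ x| ≤ D) (p : ℝ × ℝ) :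
    HasFDerivAt (fun q : ℝ × ℝ => ∫ z, ψ (q.1 + q.2 * z) ∂gaussianReal 0 1)
      ((∫ z, deriv ψ (p.1 + p.2 * z) ∂gaussianReal 0 1) • ContinuousLinearMap.fst ℝ ℝ ℝ +
        (∫ z, deriv ψ (p.1 + p.2 * z) * z ∂gaussianReal 0 1) •
          ContinuousLinearMap.snd ℝ ℝ ℝ) p := by
  have hψ' : Continuous (deriv ψ) := hψ.continuous_deriv le_rfl
  have hdiff := hψ.differentiable one_ne_zero
  have hid : Integrable (fun z : ℝ => z) (gaussianReal 0 1) :=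
    memLp_one_iff_integrable.1 (memLp_id_gaussianReal 1)
  have h0 := integrable_comp_add_mul_gaussianReal hψ' hD p.1 p.2
  have h1 := integrable_comp_add_mul_mul_self_gaussianReal hψ' hD p.1 p.2
  have hD0 : 0 ≤ D := (abs_nonneg _).trans (hD 0)
  have key := hasFDerivAt_integral_of_dominated_of_fderiv_le (𝕜 := ℝ)
    (μ := gaussianReal 0 1) (s := Set.univ) (x₀ := p)
    (F := fun (q : ℝ × ℝ) z => ψ (q.1 + q.2 * z))
    (F' := fun (q : ℝ × ℝ) z => deriv ψ (q.1 + q.2 * z) • ContinuousLinearMap.fst ℝ ℝ ℝ +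
      (deriv ψ (q.1 + q.2 * z) * z) • ContinuousLinearMap.snd ℝ ℝ ℝ)
    (bound := fun z => D + D * |z|) Filter.univ_mem
    (.of_forall fun q => (integrable_comp_add_mul_gaussianReal
      hψ.continuous hC q.1 q.2).aestronglyMeasurable)
    (integrable_comp_add_mul_gaussianReal hψ.continuous hC p.1 p.2)
    ((h0.smul_const _).aestronglyMeasurable.add (h1.smul_const _).aestronglyMeasurable)
    (ae_of_all _ fun z q _ => ?_)
    ((integrable_const D).add (hid.abs.const_mul D))
    (ae_of_all _ fun z q _ => ?_)
  · rwa [integral_add (h0.smul_const _) (h1.smul_const _), integral_smul_const,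
      integral_smul_const] at key
  · refine (norm_add_le _ _).trans (add_le_add ?_ ?_)
    · rw [norm_smul]
      exact (mul_le_of_le_one_right (norm_nonneg _) (ContinuousLinearMap.norm_fst_le ..)).trans
        (hD _)
    · rw [norm_smul, norm_mul]
      exact (mul_le_of_le_one_right (by positivity) (ContinuousLinearMap.norm_snd_le ..)).trans
        (mul_le_mul_of_nonneg_right (hD _) (norm_nonneg z))
  · have hq : HasFDerivAt (fun q : ℝ × ℝ => q.1 + q.2 * z)
        (ContinuousLinearMap.fst ℝ ℝ ℝ + z • ContinuousLinearMap.snd ℝ ℝ ℝ) q :=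
      hasFDerivAt_fst.add (hasFDerivAt_snd.mul_const z)
    convert! (hdiff (q.1 + q.2 * z)).hasDerivAt.comp_hasFDerivAt q hq using 1
    rw [smul_add, smul_smul]

lemma continuousOn_heatSemigroup_comp {ψ : ℝ → ℝ} (hψ : Continuous ψ) {C : ℝ}
    (hC : ∀ x, |ψ x| ≤ C) {S : Set ℝ} {a b : ℝ → ℝ} (ha : ContinuousOn a S)
    (ha0 : ∀ v ∈ S, 0 ≤ a v) (hb : ContinuousOn b S) :
    ContinuousOn (fun v => heatSemigroup (a v) ψ (b v)) S := by
  refine ContinuousOn.congr (f := fun v => ∫ z, ψ (b v + √(a v) * z) ∂gaussianReal 0 1) ?_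
    fun v hv => heatSemigroup_eq_integral_gaussianReal hψ (ha0 v hv) _
  refine continuousOn_of_dominated (bound := fun _ => C)
    (fun v _ => (integrable_comp_add_mul_gaussianReal hψ hC _ _).aestronglyMeasurable)
    (fun v _ => ae_of_all _ fun z => hC _) (integrable_const C) (ae_of_all _ fun z => ?_)
  exact hψ.comp_continuousOn (hb.add (ha.sqrt.mul continuousOn_const))

lemma hasDerivAt_heatSemigroup_comp {φ : ℝ → ℝ} (hφ : ContDiff ℝ 2 φ) {C C' C'' : ℝ}
    (hC : ∀ x, |φ x| ≤ C) (hC' : ∀ x, |deriv φ x| ≤ C') (hC'' : ∀ x, |deriv (deriv φ) x| ≤ C'')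
    {a b : ℝ → ℝ} {a' b' v : ℝ} (ha : HasDerivAt a a' v) (hb : HasDerivAt b b' v)
    (hav : 0 < a v) :
    HasDerivAt (fun v => heatSemigroup (a v) φ (b v))
      (heatSemigroup (a v) (deriv φ) (b v) * b' +
        1 / 2 * (heatSemigroup (a v) (deriv (deriv φ)) (b v) * a')) v := by
  have hφ' : ContDiff ℝ 1 (deriv φ) :=
    ((contDiff_succ_iff_deriv (n := 1)).1 (by simpa [one_add_one_eq_two] using hφ)).2.2
  have hs : HasDerivAt (fun v => √(a v)) (a' / (2 * √(a v))) v := ha.sqrt hav.ne'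
  have key := (hasFDerivAt_integral_comp_add_mul_gaussianReal (hφ.of_le one_le_two) hC hC'
    (b v, √(a v))).comp_hasDerivAt v (hb.prodMk hs)
  have heq : (fun v => heatSemigroup (a v) φ (b v)) =ᶠ[nhds v]
      (fun q : ℝ × ℝ => ∫ z, φ (q.1 + q.2 * z) ∂gaussianReal 0 1) ∘
        fun v => (b v, √(a v)) := by
    filter_upwards [ha.continuousAt.eventually (lt_mem_nhds hav)] with w hw
    exact heatSemigroup_eq_integral_gaussianReal hφ.continuous hw.le _
  refine (key.congr_of_eventuallyEq heq).congr_deriv ?_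
  have hsqrt : √(a v) ≠ 0 := (Real.sqrt_pos.2 hav).ne'
  rw [heatSemigroup_eq_integral_gaussianReal hφ'.continuous hav.le,
    heatSemigroup_eq_integral_gaussianReal (hφ'.continuous_deriv le_rfl) hav.le]
  simp only [integral_comp_add_mul_mul_self_gaussianReal hφ' hC' hC'', add_apply,
    smul_apply, ContinuousLinearMap.coe_fst',
    ContinuousLinearMap.coe_snd', smul_eq_mul]
  field_simp

/-- Deterministic Itô-type chain rule: let `t > 0`, let `a` be continuously differentiable on
`[0,t]` (with derivative `a'`), nondecreasing, with `a(0) = 0` and `a(v) > 0` for `v > 0`,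
let `b` be continuously differentiable on `[0,t]` (with derivative `b'`), and let `φ` be twice
continuously differentiable with `φ, φ', φ''` bounded. Then
`(P_{a(t)} φ)(b(t)) = φ(b(0)) + ∫₀ᵗ (P_{a(v)} φ')(b(v)) b'(v) dv
  + (1/2) ∫₀ᵗ (P_{a(v)} φ'')(b(v)) a'(v) dv`. -/
theorem deterministic_ito_chain_rule (t : ℝ) (ht : 0 < t)
    (a a' b b' : ℝ → ℝ)
    (ha : ∀ v ∈ Set.Icc 0 t, HasDerivAt a (a' v) v) (ha' : ContinuousOn a' (Set.Icc 0 t))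
    (hmono : MonotoneOn a (Set.Icc 0 t)) (ha0 : a 0 = 0)
    (hapos : ∀ v ∈ Set.Ioc 0 t, 0 < a v)
    (hbd : ∀ v ∈ Set.Icc 0 t, HasDerivAt b (b' v) v) (hb' : ContinuousOn b' (Set.Icc 0 t))
    (φ : ℝ → ℝ) (hφ : ContDiff ℝ 2 φ)
    (hφb : ∃ C, ∀ x, |φ x| ≤ C) (hφb' : ∃ C, ∀ x, |deriv φ x| ≤ C)
    (hφb'' : ∃ C, ∀ x, |deriv (deriv φ) x| ≤ C) :
    heatSemigroup (a t) φ (b t) =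
      φ (b 0) + (∫ v in (0:ℝ)..t, heatSemigroup (a v) (deriv φ) (b v) * b' v) +
        (1 / 2) * ∫ v in (0:ℝ)..t, heatSemigroup (a v) (deriv (deriv φ)) (b v) * a' v := by
  obtain ⟨C, hC⟩ := hφb
  obtain ⟨C', hC'⟩ := hφb'
  obtain ⟨C'', hC''⟩ := hφb''
  have hac : ContinuousOn a (Set.Icc 0 t) := fun v hv => (ha v hv).continuousAt.continuousWithinAt
  have hbc : ContinuousOn b (Set.Icc 0 t) := fun v hv => (hbd v hv).continuousAt.continuousWithinAt
  have hann : ∀ v ∈ Set.Icc 0 t, 0 ≤ a v := fun v hv =>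
    ha0 ▸ hmono (Set.left_mem_Icc.2 ht.le) hv hv.1
  have hφ' : ContDiff ℝ 1 (deriv φ) :=
    ((contDiff_succ_iff_deriv (n := 1)).1 (by simpa [one_add_one_eq_two] using hφ)).2.2
  have hi1 : IntervalIntegrable (fun v => heatSemigroup (a v) (deriv φ) (b v) * b' v)
      volume 0 t := by
    refine ContinuousOn.intervalIntegrable ?_
    rw [Set.uIcc_of_le ht.le]
    exact (continuousOn_heatSemigroup_comp hφ'.continuous hC' hac hann hbc).mul hb'
  have hi2 : IntervalIntegrable (fun v => heatSemigroup (a v) (deriv (deriv φ)) (b v) * a' v)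
      volume 0 t := by
    refine ContinuousOn.intervalIntegrable ?_
    rw [Set.uIcc_of_le ht.le]
    exact (continuousOn_heatSemigroup_comp (hφ'.continuous_deriv le_rfl) hC'' hac hann hbc).mul ha'
  have key := intervalIntegral.integral_eq_sub_of_hasDerivAt_of_le ht.le
    (continuousOn_heatSemigroup_comp hφ.continuous hC hac hann hbc)
    (fun v hv => hasDerivAt_heatSemigroup_comp hφ hC hC' hC''
      (ha v (Set.Ioo_subset_Icc_self hv)) (hbd v (Set.Ioo_subset_Icc_self hv))
      (hapos v (Set.Ioo_subset_Ioc_self hv)))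
    (hi1.add (hi2.const_mul (1 / 2)))
  rw [intervalIntegral.integral_add hi1 (hi2.const_mul _),
    intervalIntegral.integral_const_mul] at key
  have h0 : heatSemigroup (a 0) φ (b 0) = φ (b 0) := by simp [heatSemigroup, ha0]
  linarith
end

section
/- Regularized variance derivative (Zambotti comparison): fix ε > 0 and x ∈ ℝ, and define σ_ε²(t,x) := ∫₀ᵗ ∫₀¹ g_{t−s+ε}(x,y)² dy ds. Then t ↦ σ_ε²(t,x) is differentiable on (0,∞) and ∂/∂t σ_ε²(t,x) = ∫₀¹ g_ε(x,y)² dy + ∫₀ᵗ ∫₀¹ g_{t−v+ε}(x,y)·(∂²/∂x² g_{t−v+ε})(x,y) dy dv, where ∂²/∂x² g denotes the second derivative of g in its first spatial variable. -/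
open Real MeasureTheory

/-- The regularized variance `σ_ε²(t,x) := ∫₀ᵗ ∫₀¹ g_{t−s+ε}(x,y)² dy ds`. -/
noncomputable def varianceReg (ε t x : ℝ) : ℝ :=
  ∫ s in (0:ℝ)..t, ∫ y in (0:ℝ)..1, (heatKernel (t - s + ε) x y) ^ 2

/-- The `n`-th summand of the heat kernel series. -/
noncomputable def heatTerm (n : ℕ) (t x y : ℝ) : ℝ :=
  2 * Real.exp (-(((n : ℝ) + 1) ^ 2 * π ^ 2 * t) / 2) *
    Real.sin (((n : ℝ) + 1) * π * x) * Real.sin (((n : ℝ) + 1) * π * y)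

/-- The series obtained by differentiating the heat kernel twice in `x` term by term. -/
noncomputable def heatKernelXX (t x y : ℝ) : ℝ :=
  ∑' n : ℕ, -((((n : ℝ) + 1) * π) ^ 2) * heatTerm n t x y

/-- The majorant of the `k`-th order spatial derivatives of the summands for times `t ≥ δ`. -/
noncomputable def heatMajorant (k : ℕ) (δ : ℝ) (n : ℕ) : ℝ :=
  (((n : ℝ) + 1) * π) ^ k * (2 * Real.exp (-(((n : ℝ) + 1) ^ 2 * π ^ 2 * δ) / 2))

theorem summable_heatMajorant (k : ℕ) {δ : ℝ} (hδ : 0 < δ) : Summable (heatMajorant k δ) := by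
  have hr : 0 < π ^ 2 * δ / 2 := by positivity
  have h := ((summable_nat_add_iff 1).2
    (Real.summable_pow_mul_exp_neg_nat_mul k hr)).mul_left (2 * π ^ k)
  refine h.of_nonneg_of_le (fun n => by unfold heatMajorant; positivity) fun n => ?_
  have hexp : Real.exp (-(((n : ℝ) + 1) ^ 2 * π ^ 2 * δ) / 2) ≤
      Real.exp (-(π ^ 2 * δ / 2) * ((n : ℝ) + 1)) := by
    apply Real.exp_le_exp.2
    have hn : (n : ℝ) + 1 ≤ ((n : ℝ) + 1) ^ 2 := by
      have := Nat.cast_nonneg (α := ℝ) n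
      nlinarith
    nlinarith [mul_le_mul_of_nonneg_left hn hr.le]
  unfold heatMajorant
  push_cast
  calc (((n : ℝ) + 1) * π) ^ k * (2 * Real.exp (-(((n : ℝ) + 1) ^ 2 * π ^ 2 * δ) / 2))
      ≤ (((n : ℝ) + 1) * π) ^ k * (2 * Real.exp (-(π ^ 2 * δ / 2) * ((n : ℝ) + 1))) := by gcongr
    _ = _ := by rw [mul_pow]; ring

theorem abs_pow_mul_exp_mul_le (k n : ℕ) {δ t a b : ℝ} (ht : δ ≤ t) (ha : |a| ≤ 1) (hb : |b| ≤ 1) :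
    |(((n : ℝ) + 1) * π) ^ k *
      (2 * Real.exp (-(((n : ℝ) + 1) ^ 2 * π ^ 2 * t) / 2) * a * b)| ≤ heatMajorant k δ n := by
  have hab : |a| * |b| ≤ 1 := mul_le_one₀ ha (abs_nonneg _) hb
  have hpow : 0 ≤ (((n : ℝ) + 1) * π) ^ k := by positivity
  rw [abs_mul, abs_mul, abs_mul, abs_mul, Real.abs_exp, abs_two, abs_of_nonneg hpow,
    mul_assoc (2 * _)]
  unfold heatMajorant
  apply mul_le_mul_of_nonneg_left _ hpow
  calc 2 * Real.exp (-(((n : ℝ) + 1) ^ 2 * π ^ 2 * t) / 2) * (|a| * |b|)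
      ≤ 2 * Real.exp (-(((n : ℝ) + 1) ^ 2 * π ^ 2 * t) / 2) * 1 := by gcongr
    _ ≤ _ := by rw [mul_one]; gcongr

theorem abs_heatTerm_le (n : ℕ) {δ t : ℝ} (ht : δ ≤ t) (x y : ℝ) :
    |heatTerm n t x y| ≤ heatMajorant 0 δ n := by
  simpa [heatTerm] using abs_pow_mul_exp_mul_le 0 n ht
    (Real.abs_sin_le_one (((n : ℝ) + 1) * π * x)) (Real.abs_sin_le_one (((n : ℝ) + 1) * π * y))

theorem abs_heatTerm_xx_le (n : ℕ) {δ t : ℝ} (ht : δ ≤ t) (x y : ℝ) :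
    |-((((n : ℝ) + 1) * π) ^ 2) * heatTerm n t x y| ≤ heatMajorant 2 δ n := by
  rw [neg_mul, abs_neg]
  exact abs_pow_mul_exp_mul_le 2 n ht (Real.abs_sin_le_one _) (Real.abs_sin_le_one _)

theorem abs_heatKernel_le {δ t : ℝ} (hδ : 0 < δ) (ht : δ ≤ t) (x y : ℝ) :
    |heatKernel t x y| ≤ ∑' n, heatMajorant 0 δ n :=
  (Real.norm_eq_abs _).symm.trans_le <|
    tsum_of_norm_bounded (summable_heatMajorant 0 hδ).hasSum fun n => abs_heatTerm_le n ht x y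

theorem abs_heatKernelXX_le {δ t : ℝ} (hδ : 0 < δ) (ht : δ ≤ t) (x y : ℝ) :
    |heatKernelXX t x y| ≤ ∑' n, heatMajorant 2 δ n :=
  (Real.norm_eq_abs _).symm.trans_le <|
    tsum_of_norm_bounded (summable_heatMajorant 2 hδ).hasSum fun n => abs_heatTerm_xx_le n ht x y

theorem summable_heatTerm {t : ℝ} (ht : 0 < t) (x y : ℝ) :
    Summable fun n => heatTerm n t x y :=
  .of_norm_bounded (summable_heatMajorant 0 ht) fun n => abs_heatTerm_le n le_rfl x y

theorem continuous_heatKernel_right {t : ℝ} (ht : 0 < t) (x : ℝ) :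
    Continuous fun y => heatKernel t x y :=
  continuous_tsum (fun n => by fun_prop) (summable_heatMajorant 0 ht)
    fun n y => abs_heatTerm_le n le_rfl x y

theorem continuous_heatKernelXX_right {t : ℝ} (ht : 0 < t) (x : ℝ) :
    Continuous fun y => heatKernelXX t x y :=
  continuous_tsum (fun n => by unfold heatTerm; fun_prop) (summable_heatMajorant 2 ht)
    fun n y => abs_heatTerm_xx_le n le_rfl x y

theorem continuousAt_heatKernelXX_time {t : ℝ} (ht : 0 < t) (x y : ℝ) :
    ContinuousAt (fun s => heatKernelXX s x y) t := by
  have h : ContinuousOn (fun s => heatKernelXX s x y) (Set.Ici (t / 2)) :=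
    continuousOn_tsum (fun n => by unfold heatTerm; fun_prop)
      (summable_heatMajorant 2 (half_pos ht)) fun n s hs => abs_heatTerm_xx_le n hs x y
  exact h.continuousAt (Ici_mem_nhds (half_lt_self ht))

/-- The heat equation `∂ₜ g = ½ ∂ₓ² g`. -/
theorem hasDerivAt_heatKernel_time_s18 {t : ℝ} (ht : 0 < t) (x y : ℝ) :
    HasDerivAt (fun s => heatKernel s x y) (heatKernelXX t x y / 2) t := by
  have h : HasDerivAt (fun s => ∑' n, heatTerm n s x y)
      (∑' n : ℕ, -((((n : ℝ) + 1) * π) ^ 2) * heatTerm n t x y / 2) t := by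
    refine hasDerivAt_tsum_of_isPreconnected (t := Set.Ioi (t / 2))
      (g' := fun (n : ℕ) s => -((((n : ℝ) + 1) * π) ^ 2) * heatTerm n s x y / 2)
      (summable_heatMajorant 2 (half_pos ht)) isOpen_Ioi isPreconnected_Ioi
      (fun n s _ => ?_) (fun n s hs => ?_) (half_lt_self ht) (summable_heatTerm ht x y)
      (half_lt_self ht)
    · have h1 : HasDerivAt (fun s : ℝ => -(((n : ℝ) + 1) ^ 2 * π ^ 2 * s) / 2)
          (-(((n : ℝ) + 1) ^ 2 * π ^ 2 * 1) / 2) s :=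
        (((hasDerivAt_id s).const_mul _).neg).div_const 2
      have h2 := ((h1.exp.const_mul 2).mul_const
        (Real.sin (((n : ℝ) + 1) * π * x))).mul_const (Real.sin (((n : ℝ) + 1) * π * y))
      refine h2.congr_deriv ?_
      unfold heatTerm
      ring
    · have hb := abs_heatTerm_xx_le n (le_of_lt hs) x y
      rw [Real.norm_eq_abs, abs_div, abs_two]
      linarith [abs_nonneg (-((((n : ℝ) + 1) * π) ^ 2) * heatTerm n s x y)]
  rw [tsum_div_const] at h
  exact h

theorem deriv_deriv_heatKernel {t : ℝ} (ht : 0 < t) (x y : ℝ) :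
    deriv (deriv fun x' => heatKernel t x' y) x = heatKernelXX t x y := by
  let d : ℕ → ℝ → ℝ := fun n x' => (((n : ℝ) + 1) * π) ^ 1 *
    (2 * Real.exp (-(((n : ℝ) + 1) ^ 2 * π ^ 2 * t) / 2) *
      Real.cos (((n : ℝ) + 1) * π * x') * Real.sin (((n : ℝ) + 1) * π * y))
  have hd (n : ℕ) (x' : ℝ) : ‖d n x'‖ ≤ heatMajorant 1 t n :=
    abs_pow_mul_exp_mul_le 1 n le_rfl (Real.abs_cos_le_one _) (Real.abs_sin_le_one _)
  have hlin (n : ℕ) (x' : ℝ) : HasDerivAt (fun z : ℝ => ((n : ℝ) + 1) * π * z)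
      (((n : ℝ) + 1) * π * 1) x' := (hasDerivAt_id x').const_mul _
  have h1 (x' : ℝ) : HasDerivAt (fun z => heatKernel t z y) (∑' n, d n x') x' := by
    refine hasDerivAt_tsum (g := fun n z => heatTerm n t z y) (summable_heatMajorant 1 ht)
      (fun n z => ?_) hd (summable_heatTerm ht x y) x'
    refine (((hlin n z).sin.const_mul _).mul_const _).congr_deriv ?_
    simp only [d]
    ring
  have hsum : Summable fun n => d n x :=
    .of_norm_bounded (summable_heatMajorant 1 ht) fun n => hd n x
  have h2 : HasDerivAt (fun z => ∑' n, d n z) (heatKernelXX t x y) x := by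
    refine hasDerivAt_tsum (g' := fun (n : ℕ) z => -((((n : ℝ) + 1) * π) ^ 2) * heatTerm n t z y)
      (summable_heatMajorant 2 ht)
      (fun n z => ?_) (fun n z => abs_heatTerm_xx_le n le_rfl z y) hsum x
    refine ((((hlin n z).cos.const_mul _).mul_const _).const_mul _).congr_deriv ?_
    unfold heatTerm
    ring
  rw [funext fun x' => (h1 x').deriv]
  exact h2.deriv

theorem hasDerivAt_integral_heatKernel_sq {t : ℝ} (ht : 0 < t) (x : ℝ) :
    HasDerivAt (fun s => ∫ y in (0:ℝ)..1, heatKernel s x y ^ 2)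
      (∫ y in (0:ℝ)..1, heatKernel t x y * heatKernelXX t x y) t := by
  have hpos {s : ℝ} (hs : s ∈ Set.Ioi (t / 2)) : 0 < s := (half_pos ht).trans hs
  have hmem : Set.Ioi (t / 2) ∈ nhds t := Ioi_mem_nhds (half_lt_self ht)
  refine (intervalIntegral.hasDerivAt_integral_of_dominated_loc_of_deriv_le
    (F' := fun s y => heatKernel s x y * heatKernelXX s x y)
    (bound := fun _ => (∑' n, heatMajorant 0 (t / 2) n) * ∑' n, heatMajorant 2 (t / 2) n)
    hmem ?_ ?_ ?_ ?_ ?_ ?_).2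
  · filter_upwards [hmem] with s hs
    exact ((continuous_heatKernel_right (hpos hs) x).pow 2).aestronglyMeasurable
  · exact ((continuous_heatKernel_right ht x).pow 2).intervalIntegrable _ _
  · exact ((continuous_heatKernel_right ht x).mul
      (continuous_heatKernelXX_right ht x)).aestronglyMeasurable
  · refine .of_forall fun y _ s hs => ?_
    rw [norm_mul]
    have h0 := abs_heatKernel_le (half_pos ht) (le_of_lt hs) x y
    exact mul_le_mul h0 (abs_heatKernelXX_le (half_pos ht) (le_of_lt hs) x y) (norm_nonneg _)
      ((abs_nonneg _).trans h0)
  · exact intervalIntegrable_const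
  · refine .of_forall fun y _ s hs => ?_
    refine ((hasDerivAt_heatKernel_time_s18 (hpos hs) x y).pow 2).congr_deriv ?_
    push_cast
    ring

theorem continuousAt_integral_heatKernel_mul_heatKernelXX {t : ℝ} (ht : 0 < t) (x : ℝ) :
    ContinuousAt (fun s => ∫ y in (0:ℝ)..1, heatKernel s x y * heatKernelXX s x y) t := by
  have hmem : Set.Ioi (t / 2) ∈ nhds t := Ioi_mem_nhds (half_lt_self ht)
  refine intervalIntegral.continuousAt_of_dominated_interval
    (bound := fun _ => (∑' n, heatMajorant 0 (t / 2) n) * ∑' n, heatMajorant 2 (t / 2) n)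
    ?_ ?_ intervalIntegrable_const ?_
  · filter_upwards [hmem] with s hs
    have hs' : 0 < s := (half_pos ht).trans hs
    exact ((continuous_heatKernel_right hs' x).mul
      (continuous_heatKernelXX_right hs' x)).aestronglyMeasurable
  · filter_upwards [hmem] with s hs
    refine .of_forall fun y _ => ?_
    rw [norm_mul]
    have h0 := abs_heatKernel_le (half_pos ht) (le_of_lt hs) x y
    exact mul_le_mul h0 (abs_heatKernelXX_le (half_pos ht) (le_of_lt hs) x y) (norm_nonneg _)
      ((abs_nonneg _).trans h0)
  · exact .of_forall fun y _ => (hasDerivAt_heatKernel_time_s18 ht x y).continuousAt.mul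
      (continuousAt_heatKernelXX_time ht x y)

/-- Time reversal and shift of an integral over `[0, t]`. -/
theorem integral_comp_sub_add (f : ℝ → ℝ) (ε t : ℝ) :
    ∫ s in (0:ℝ)..t, f (t - s + ε) = ∫ u in ε..t + ε, f u := by
  have h := intervalIntegral.integral_comp_sub_left (a := 0) (b := t) f (t + ε)
  rw [add_sub_cancel_left, sub_zero] at h
  rw [← h]
  congr 1 with s
  congr 1
  ring

/-- Regularized variance derivative (Zambotti comparison): for fixed `ε > 0` and `x ∈ ℝ`,
`t ↦ σ_ε²(t,x)` is differentiable on `(0,∞)` with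
`∂/∂t σ_ε²(t,x) = ∫₀¹ g_ε(x,y)² dy
  + ∫₀ᵗ ∫₀¹ g_{t−v+ε}(x,y)·(∂²/∂x² g_{t−v+ε})(x,y) dy dv`,
where `∂²/∂x² g` is the second derivative of `g` in its first spatial variable. -/
theorem varianceReg_hasDerivAt (ε : ℝ) (hε : 0 < ε) (x : ℝ) :
    ∀ t > (0:ℝ),
      HasDerivAt (fun t' => varianceReg ε t' x)
        ((∫ y in (0:ℝ)..1, (heatKernel ε x y) ^ 2) +
          ∫ v in (0:ℝ)..t, ∫ y in (0:ℝ)..1,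
            heatKernel (t - v + ε) x y *
              deriv (deriv fun x' => heatKernel (t - v + ε) x' y) x) t := by
  intro t ht
  have hpos {u : ℝ} (hu : u ∈ Set.uIcc ε (t + ε)) : 0 < u := by
    rw [Set.uIcc_of_le (by linarith)] at hu
    exact hε.trans_le hu.1
  have hderiv : (∫ v in (0:ℝ)..t, ∫ y in (0:ℝ)..1, heatKernel (t - v + ε) x y *
      deriv (deriv fun x' => heatKernel (t - v + ε) x' y) x) =
      (∫ y in (0:ℝ)..1, heatKernel (t + ε) x y ^ 2) - ∫ y in (0:ℝ)..1, heatKernel ε x y ^ 2 := by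
    rw [integral_comp_sub_add (fun u => ∫ y in (0:ℝ)..1, heatKernel u x y *
      deriv (deriv fun x' => heatKernel u x' y) x) ε t]
    have hxx : Set.EqOn (fun u => ∫ y in (0:ℝ)..1, heatKernel u x y *
        deriv (deriv fun x' => heatKernel u x' y) x)
        (fun u => ∫ y in (0:ℝ)..1, heatKernel u x y * heatKernelXX u x y)
        (Set.uIcc ε (t + ε)) := fun u hu => by
      simp only [deriv_deriv_heatKernel (hpos hu)]
    rw [intervalIntegral.integral_congr hxx]
    exact intervalIntegral.integral_eq_sub_of_hasDerivAt
      (fun u hu => hasDerivAt_integral_heatKernel_sq (hpos hu) x)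
      (ContinuousOn.intervalIntegrable fun u hu =>
        (continuousAt_integral_heatKernel_mul_heatKernelXX (hpos hu) x).continuousWithinAt)
  have hvar : (fun t' => varianceReg ε t' x) =
      fun t' => ∫ u in ε..t' + ε, ∫ y in (0:ℝ)..1, heatKernel u x y ^ 2 :=
    funext fun t' => integral_comp_sub_add (fun u => ∫ y in (0:ℝ)..1, heatKernel u x y ^ 2) ε t'
  have hcont : ContinuousOn (fun u => ∫ y in (0:ℝ)..1, heatKernel u x y ^ 2) (Set.Ioi 0) :=
    fun u hu => (hasDerivAt_integral_heatKernel_sq hu x).continuousAt.continuousWithinAt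
  have htε : t + ε ∈ Set.Ioi (0:ℝ) := add_pos ht hε
  rw [hderiv, hvar, add_sub_cancel]
  exact (intervalIntegral.integral_hasDerivAt_right
    (hcont.mono fun u hu => hpos hu).intervalIntegrable
    (hcont.stronglyMeasurableAtFilter isOpen_Ioi _ htε)
    (hcont.continuousAt (Ioi_mem_nhds htε))).comp_add_const t ε
end
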